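/- Let V₁ ∈ ℂ^{M×r₁} and V₂ ∈ ℂ^{M×r₂} have orthonormal columns, let Σ₁ ∈ ℝ^{r₁×r₁} and Σ₂ ∈ ℝ^{r₂×r₂} be diagonal with strictly positive diagonal entries, let X ∈ ℂ^{n×M}, and let γ > 0. Then: (i) the block matrix N = [[I_{r₁}, V₁ᴴV₂], [V₂ᴴV₁, I_{r₂} + γΣ₂⁻²]] ∈ ℂ^{(r₁+r₂)×(r₁+r₂)} is invertible; and (ii) the function J(Ĉ₁, Ĉ₂) = ‖Xᴴ − V₁Σ₁Ĉ₁ᴴ − V₂Σ₂Ĉ₂ᴴ‖_F² + γ‖Ĉ₂‖_F² has a unique minimizer over ℂ^{n×r₁} × ℂ^{n×r₂}, given by stacking [Ĉ₁ᴴ; Ĉ₂ᴴ] = blockdiag(Σ₁, Σ₂)⁻¹ · N⁻¹ · [V₁ᴴXᴴ; V₂ᴴXᴴ]. -/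

import Mathlib

open Matrix

/-- Squared Frobenius norm of a complex matrix. -/
noncomputable def frobSq {m n : Type*} [Fintype m] [Fintype n] (A : Matrix m n ℂ) : ℝ :=
  ∑ i, ∑ j, ‖A i j‖ ^ 2

/-- The regularized partially linear multi-kernel regression objective
`J(Ĉ₁, Ĉ₂) = ‖Xᴴ − V₁Σ₁Ĉ₁ᴴ − V₂Σ₂Ĉ₂ᴴ‖_F² + γ‖Ĉ₂‖_F²`. -/
noncomputable def mkObjective {M n r₁ r₂ : ℕ}
    (X : Matrix (Fin n) (Fin M) ℂ)
    (V₁ : Matrix (Fin M) (Fin r₁) ℂ) (V₂ : Matrix (Fin M) (Fin r₂) ℂ)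
    (S₁ : Matrix (Fin r₁) (Fin r₁) ℂ) (S₂ : Matrix (Fin r₂) (Fin r₂) ℂ)
    (γ : ℝ)
    (C₁ : Matrix (Fin n) (Fin r₁) ℂ) (C₂ : Matrix (Fin n) (Fin r₂) ℂ) : ℝ :=
  frobSq (Xᴴ - V₁ * S₁ * C₁ᴴ - V₂ * S₂ * C₂ᴴ) + γ * frobSq C₂

theorem frobSq_nonneg {m n : Type*} [Fintype m] [Fintype n] (A : Matrix m n ℂ) :
    0 ≤ frobSq A := by
  unfold frobSq
  positivity

theorem eq_zero_of_frobSq_nonpos {m n : Type*} [Fintype m] [Fintype n] {A : Matrix m n ℂ}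
    (h : frobSq A ≤ 0) : A = 0 := by
  have h0 : frobSq A = 0 := le_antisymm h (frobSq_nonneg A)
  unfold frobSq at h0
  ext i j
  rw [Finset.sum_eq_zero_iff_of_nonneg fun i _ => by positivity] at h0
  have hi := h0 i (Finset.mem_univ i)
  rw [Finset.sum_eq_zero_iff_of_nonneg fun j _ => by positivity] at hi
  simpa using hi j (Finset.mem_univ j)

theorem frobSq_conjTranspose {m n : Type*} [Fintype m] [Fintype n] (A : Matrix m n ℂ) :
    frobSq Aᴴ = frobSq A := by
  simp only [frobSq, conjTranspose_apply, norm_star]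
  exact Finset.sum_comm

theorem frobSq_smul {m n : Type*} [Fintype m] [Fintype n] (c : ℂ) (A : Matrix m n ℂ) :
    frobSq (c • A) = ‖c‖ ^ 2 * frobSq A := by
  simp [frobSq, mul_pow, Finset.mul_sum]

theorem frobSq_fromRows {m₁ m₂ n : Type*} [Fintype m₁] [Fintype m₂] [Fintype n]
    (A : Matrix m₁ n ℂ) (B : Matrix m₂ n ℂ) :
    frobSq (fromRows A B) = frobSq A + frobSq B := by
  simp [frobSq]

theorem ofReal_frobSq {m n : Type*} [Fintype m] [Fintype n] (A : Matrix m n ℂ) :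
    (frobSq A : ℂ) = (Aᴴ * A).trace := by
  simp only [frobSq, trace, diag, mul_apply, conjTranspose_apply]
  rw [Finset.sum_comm]
  push_cast
  refine Finset.sum_congr rfl fun i _ => Finset.sum_congr rfl fun j _ => ?_
  exact (Complex.conj_mul' _).symm

/-- The Pythagorean identity for the Frobenius norm. -/
theorem frobSq_add_of_conjTranspose_mul_eq_zero {m n : Type*} [Fintype m] [Fintype n]
    {P Q : Matrix m n ℂ} (h : Qᴴ * P = 0) : frobSq (P + Q) = frobSq P + frobSq Q := by
  have h' : Pᴴ * Q = 0 := by simpa using congrArg conjTranspose h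
  apply Complex.ofReal_injective
  push_cast
  simp only [ofReal_frobSq, conjTranspose_add, Matrix.add_mul, Matrix.mul_add, h, h', trace_add,
    trace_zero]
  ring

/-- A matrix of full column rank has a unique least-squares solution, given by the normal
equations. -/
theorem forall_frobSq_sub_le_iff {m n k : Type*} [Fintype m] [Fintype n] [Fintype k]
    [DecidableEq k] {A : Matrix m k ℂ} (hA : IsUnit (Aᴴ * A)) (B : Matrix m n ℂ)
    (K : Matrix k n ℂ) :
    (∀ K' : Matrix k n ℂ, frobSq (B - A * K) ≤ frobSq (B - A * K')) ↔
      K = (Aᴴ * A)⁻¹ * (Aᴴ * B) := by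
  have hdet := (isUnit_iff_isUnit_det _).1 hA
  set K₀ := (Aᴴ * A)⁻¹ * (Aᴴ * B) with hK₀
  have hnormal : Aᴴ * (B - A * K₀) = 0 := by
    rw [Matrix.mul_sub, ← Matrix.mul_assoc, hK₀, mul_nonsing_inv_cancel_left _ _ hdet, sub_self]
  have hsplit (L : Matrix k n ℂ) :
      frobSq (B - A * L) = frobSq (B - A * K₀) + frobSq (A * (K₀ - L)) := by
    rw [← frobSq_add_of_conjTranspose_mul_eq_zero, Matrix.mul_sub, sub_add_sub_cancel]
    rw [conjTranspose_mul, Matrix.mul_assoc, hnormal, Matrix.mul_zero]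
  constructor
  · intro h
    have hle := h K₀
    rw [hsplit K] at hle
    have hz : A * (K₀ - K) = 0 := eq_zero_of_frobSq_nonpos (by linarith)
    have hsub : K₀ - K = 0 := by
      rw [← nonsing_inv_mul_cancel_left _ (K₀ - K) hdet, Matrix.mul_assoc Aᴴ, hz]
      simp
    exact (sub_eq_zero.1 hsub).symm
  · rintro rfl L
    rw [hsplit L]
    linarith [frobSq_nonneg (A * (K₀ - L))]

/-- The design matrix of the regularized problem, with the penalty as additional rows. -/
noncomputable def mkDesign {M r₁ r₂ : ℕ}
    (V₁ : Matrix (Fin M) (Fin r₁) ℂ) (V₂ : Matrix (Fin M) (Fin r₂) ℂ)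
    (S₁ : Matrix (Fin r₁) (Fin r₁) ℂ) (S₂ : Matrix (Fin r₂) (Fin r₂) ℂ) (γ : ℝ) :
    Matrix (Fin M ⊕ Fin r₂) (Fin r₁ ⊕ Fin r₂) ℂ :=
  fromBlocks (V₁ * S₁) (V₂ * S₂) 0 ((√γ : ℂ) • 1)

theorem mkObjective_eq_frobSq {M n r₁ r₂ : ℕ} (X : Matrix (Fin n) (Fin M) ℂ)
    (V₁ : Matrix (Fin M) (Fin r₁) ℂ) (V₂ : Matrix (Fin M) (Fin r₂) ℂ)
    (S₁ : Matrix (Fin r₁) (Fin r₁) ℂ) (S₂ : Matrix (Fin r₂) (Fin r₂) ℂ) {γ : ℝ} (hγ : 0 ≤ γ)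
    (C₁ : Matrix (Fin n) (Fin r₁) ℂ) (C₂ : Matrix (Fin n) (Fin r₂) ℂ) :
    mkObjective X V₁ V₂ S₁ S₂ γ C₁ C₂ =
      frobSq (fromRows Xᴴ 0 - mkDesign V₁ V₂ S₁ S₂ γ * fromRows C₁ᴴ C₂ᴴ) := by
  have hrows : fromRows Xᴴ 0 - mkDesign V₁ V₂ S₁ S₂ γ * fromRows C₁ᴴ C₂ᴴ =
      fromRows (Xᴴ - V₁ * S₁ * C₁ᴴ - V₂ * S₂ * C₂ᴴ) (-(√γ : ℂ) • C₂ᴴ) := by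
    rw [mkDesign, fromBlocks_mul_fromRows]
    ext (i | i) j <;> simp [sub_sub]
  rw [hrows, frobSq_fromRows, frobSq_smul, frobSq_conjTranspose, mkObjective]
  simp [Real.sq_sqrt hγ]

theorem mkDesign_mulVec_injective {M r₁ r₂ : ℕ}
    {V₁ : Matrix (Fin M) (Fin r₁) ℂ} (V₂ : Matrix (Fin M) (Fin r₂) ℂ) (hV₁ : V₁ᴴ * V₁ = 1)
    {S₁ : Matrix (Fin r₁) (Fin r₁) ℂ} (hS₁ : IsUnit S₁.det)
    (S₂ : Matrix (Fin r₂) (Fin r₂) ℂ) {γ : ℝ} (hγ : 0 < γ) :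
    Function.Injective (mkDesign V₁ V₂ S₁ S₂ γ).mulVec := by
  have hγ' : (√γ : ℂ) ≠ 0 := by exact_mod_cast (Real.sqrt_pos.2 hγ).ne'
  let L : Matrix (Fin r₁ ⊕ Fin r₂) (Fin M ⊕ Fin r₂) ℂ :=
    fromBlocks (S₁⁻¹ * V₁ᴴ) (-(√γ : ℂ)⁻¹ • (S₁⁻¹ * V₁ᴴ * (V₂ * S₂))) 0 ((√γ : ℂ)⁻¹ • 1)
  have hleft : L * mkDesign V₁ V₂ S₁ S₂ γ = 1 := by
    have h₁₁ : S₁⁻¹ * V₁ᴴ * (V₁ * S₁) = 1 := by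
      rw [Matrix.mul_assoc, ← Matrix.mul_assoc V₁ᴴ, hV₁, Matrix.one_mul, nonsing_inv_mul _ hS₁]
    rw [mkDesign, fromBlocks_multiply, h₁₁, ← fromBlocks_one]
    simp [-Complex.coe_smul, smul_smul, hγ']
  intro x y hxy
  simpa [mulVec_mulVec, hleft] using congrArg L.mulVec hxy

open scoped ComplexOrder in
theorem isUnit_conjTranspose_mkDesign_mul_self {M r₁ r₂ : ℕ}
    {V₁ : Matrix (Fin M) (Fin r₁) ℂ} (V₂ : Matrix (Fin M) (Fin r₂) ℂ) (hV₁ : V₁ᴴ * V₁ = 1)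
    {S₁ : Matrix (Fin r₁) (Fin r₁) ℂ} (hS₁ : IsUnit S₁.det)
    (S₂ : Matrix (Fin r₂) (Fin r₂) ℂ) {γ : ℝ} (hγ : 0 < γ) :
    IsUnit ((mkDesign V₁ V₂ S₁ S₂ γ)ᴴ * mkDesign V₁ V₂ S₁ S₂ γ) :=
  (PosDef.conjTranspose_mul_self _ (mkDesign_mulVec_injective V₂ hV₁ hS₁ S₂ hγ)).isUnit

theorem conjTranspose_mkDesign_mul_self {M r₁ r₂ : ℕ}
    {V₁ : Matrix (Fin M) (Fin r₁) ℂ} {V₂ : Matrix (Fin M) (Fin r₂) ℂ}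
    (hV₁ : V₁ᴴ * V₁ = 1) (hV₂ : V₂ᴴ * V₂ = 1)
    {S₁ : Matrix (Fin r₁) (Fin r₁) ℂ} {S₂ : Matrix (Fin r₂) (Fin r₂) ℂ}
    (hS₁ : S₁.IsHermitian) (hS₂ : S₂.IsHermitian) (hS₂' : IsUnit S₂.det)
    {γ : ℝ} (hγ : 0 ≤ γ) :
    (mkDesign V₁ V₂ S₁ S₂ γ)ᴴ * mkDesign V₁ V₂ S₁ S₂ γ =
      fromBlocks S₁ 0 0 S₂ *
        fromBlocks 1 (V₁ᴴ * V₂) (V₂ᴴ * V₁) (1 + (γ : ℂ) • (S₂⁻¹ * S₂⁻¹)) *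
          fromBlocks S₁ 0 0 S₂ := by
  have hsq : √γ * √γ = γ := Real.mul_self_sqrt hγ
  have h₁₁ : S₁ * V₁ᴴ * (V₁ * S₁) = S₁ * S₁ := by
    rw [Matrix.mul_assoc, ← Matrix.mul_assoc V₁ᴴ, hV₁, Matrix.one_mul]
  have h₂₂ : S₂ * V₂ᴴ * (V₂ * S₂) = S₂ * S₂ := by
    rw [Matrix.mul_assoc, ← Matrix.mul_assoc V₂ᴴ, hV₂, Matrix.one_mul]
  have hinv : S₂ * (S₂⁻¹ * S₂⁻¹) * S₂ = 1 := by
    rw [mul_nonsing_inv_cancel_left _ _ hS₂', nonsing_inv_mul _ hS₂']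
  rw [mkDesign, fromBlocks_conjTranspose, fromBlocks_multiply, fromBlocks_multiply,
    fromBlocks_multiply]
  simp only [conjTranspose_mul, hS₁.eq, hS₂.eq, h₁₁, h₂₂]
  simp [smul_smul, hsq, Matrix.mul_add, Matrix.add_mul, hinv, Matrix.mul_assoc]

theorem isUnit_det_diagonal_ofReal {r : ℕ} {σ : Fin r → ℝ} (hσ : ∀ i, 0 < σ i) :
    IsUnit (diagonal fun i => (σ i : ℂ)).det := by
  rw [det_diagonal, isUnit_iff_ne_zero, Finset.prod_ne_zero_iff]
  exact fun i _ => by exact_mod_cast (hσ i).ne'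

theorem isHermitian_diagonal_ofReal {r : ℕ} (σ : Fin r → ℝ) :
    (diagonal fun i => (σ i : ℂ)).IsHermitian :=
  isHermitian_diagonal_iff.2 fun i => Complex.conj_ofReal (σ i)

/-- (i) The block matrix `N = [[I, V₁ᴴV₂], [V₂ᴴV₁, I + γΣ₂⁻²]]` is invertible, and
(ii) the regularized partially linear regression objective has a unique minimizer,
given by `[Ĉ₁ᴴ; Ĉ₂ᴴ] = blockdiag(Σ₁,Σ₂)⁻¹ N⁻¹ [V₁ᴴXᴴ; V₂ᴴXᴴ]`. -/
theorem multikernel_regression_solution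
    {M n r₁ r₂ : ℕ}
    (V₁ : Matrix (Fin M) (Fin r₁) ℂ) (V₂ : Matrix (Fin M) (Fin r₂) ℂ)
    (hV₁ : V₁ᴴ * V₁ = 1) (hV₂ : V₂ᴴ * V₂ = 1)
    (σ₁ : Fin r₁ → ℝ) (σ₂ : Fin r₂ → ℝ)
    (hσ₁ : ∀ i, 0 < σ₁ i) (hσ₂ : ∀ i, 0 < σ₂ i)
    (X : Matrix (Fin n) (Fin M) ℂ)
    (γ : ℝ) (hγ : 0 < γ)
    (S₁ : Matrix (Fin r₁) (Fin r₁) ℂ) (S₂ : Matrix (Fin r₂) (Fin r₂) ℂ)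
    (hS₁ : S₁ = Matrix.diagonal (fun i => (σ₁ i : ℂ)))
    (hS₂ : S₂ = Matrix.diagonal (fun i => (σ₂ i : ℂ)))
    (Nmat : Matrix (Fin r₁ ⊕ Fin r₂) (Fin r₁ ⊕ Fin r₂) ℂ)
    (hN : Nmat = Matrix.fromBlocks 1 (V₁ᴴ * V₂) (V₂ᴴ * V₁)
        (1 + (γ : ℂ) • (S₂⁻¹ * S₂⁻¹))) :
    IsUnit Nmat
    ∧ ∀ (C₁ : Matrix (Fin n) (Fin r₁) ℂ) (C₂ : Matrix (Fin n) (Fin r₂) ℂ),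
        (∀ (C₁' : Matrix (Fin n) (Fin r₁) ℂ) (C₂' : Matrix (Fin n) (Fin r₂) ℂ),
            mkObjective X V₁ V₂ S₁ S₂ γ C₁ C₂ ≤ mkObjective X V₁ V₂ S₁ S₂ γ C₁' C₂')
          ↔ Matrix.fromRows C₁ᴴ C₂ᴴ
              = (Matrix.fromBlocks S₁ 0 0 S₂)⁻¹ * Nmat⁻¹
                  * Matrix.fromRows (V₁ᴴ * Xᴴ) (V₂ᴴ * Xᴴ) := by
  have hd₁ : IsUnit S₁.det := hS₁ ▸ isUnit_det_diagonal_ofReal hσ₁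
  have hd₂ : IsUnit S₂.det := hS₂ ▸ isUnit_det_diagonal_ofReal hσ₂
  have hh₁ : S₁.IsHermitian := hS₁ ▸ isHermitian_diagonal_ofReal σ₁
  have hh₂ : S₂.IsHermitian := hS₂ ▸ isHermitian_diagonal_ofReal σ₂
  have hS : IsUnit (fromBlocks S₁ 0 0 S₂).det := by
    rw [det_fromBlocks_zero₂₁]
    exact hd₁.mul hd₂
  have hgram := conjTranspose_mkDesign_mul_self hV₁ hV₂ hh₁ hh₂ hd₂ hγ.le
  rw [← hN] at hgram
  have hunit := isUnit_conjTranspose_mkDesign_mul_self V₂ hV₁ hd₁ S₂ hγ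
  have hrhs : (mkDesign V₁ V₂ S₁ S₂ γ)ᴴ * fromRows Xᴴ (0 : Matrix (Fin r₂) (Fin n) ℂ) =
      fromBlocks S₁ 0 0 S₂ * fromRows (V₁ᴴ * Xᴴ) (V₂ᴴ * Xᴴ) := by
    rw [mkDesign, fromBlocks_conjTranspose, fromBlocks_mul_fromRows, fromBlocks_mul_fromRows]
    simp [hh₁.eq, hh₂.eq, Matrix.mul_assoc]
  refine ⟨?_, fun C₁ C₂ => ?_⟩
  · rw [isUnit_iff_isUnit_det, hgram, det_mul, det_mul] at hunit
    rw [isUnit_iff_isUnit_det]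
    exact isUnit_of_mul_isUnit_right (isUnit_of_mul_isUnit_left hunit)
  · have hsol := forall_frobSq_sub_le_iff hunit (fromRows Xᴴ 0) (fromRows C₁ᴴ C₂ᴴ)
    rw [hrhs, hgram, Matrix.mul_inv_rev, Matrix.mul_inv_rev, Matrix.mul_assoc, Matrix.mul_assoc,
      nonsing_inv_mul_cancel_left _ _ hS, ← Matrix.mul_assoc] at hsol
    rw [← hsol]
    simp only [mkObjective_eq_frobSq X V₁ V₂ S₁ S₂ hγ.le]
    refine ⟨fun h K => ?_, fun h C₁' C₂' => h _⟩
    simpa using h K.toRows₁ᴴ K.toRows₂ᴴ
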